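/- Assume the box-diagonal EPCAG setting, except that instead of g₊(t,0,0) = 0 = g₋(t,0,0) assume only ‖g₊(t,0,0)‖ ≤ H and ‖g₋(t,0,0)‖ ≤ H for all t ∈ ℝ, for a constant H > 0. Assume condition (bw) and the smallness condition 2KL/σ < 1. Then there exists exactly one solution z of system (3*) that is bounded on ℝ, and it satisfies ‖z(t)‖ ≤ 2KH/(σ − 2KL) for all t ∈ ℝ. -/

import Mathlib

open Set Real Filter MeasureTheory

noncomputable section

abbrev Ek (k : ℕ) : Type := EuclideanSpace ℝ (Fin k)

/-- `z` is a solution of the box-diagonal EPCAG system (3*) on the set `J`: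
`z` is continuous on `J`, has the prescribed right derivative at every point of `J`,
and at points not of the form `θ i` it is differentiable (within `J`). -/
def SolOn {k m : ℕ} (θ : ℤ → ℝ) (β : ℝ → ℝ)
    (Bp : ℝ → Ek k →L[ℝ] Ek k) (Bm : ℝ → Ek m →L[ℝ] Ek m)
    (gp : ℝ → Ek k × Ek m → Ek k × Ek m → Ek k)
    (gm : ℝ → Ek k × Ek m → Ek k × Ek m → Ek m)
    (z : ℝ → Ek k × Ek m) (J : Set ℝ) : Prop :=
  ContinuousOn z J ∧
  ∀ t ∈ J,
    (HasDerivWithinAt (fun s => (z s).1)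
        (Bp t (z t).1 + gp t (z t) (z (β t))) (Ici t ∩ J) t ∧
      HasDerivWithinAt (fun s => (z s).2)
        (Bm t (z t).2 + gm t (z t) (z (β t))) (Ici t ∩ J) t) ∧
    (t ∉ Set.range θ →
      HasDerivWithinAt (fun s => (z s).1)
        (Bp t (z t).1 + gp t (z t) (z (β t))) J t ∧
      HasDerivWithinAt (fun s => (z s).2)
        (Bm t (z t).2 + gm t (z t) (z (β t))) J t)

/-- `W` is the transition operator of `x' = B t x`, where `‖B t‖` is bounded by `μ`. -/
structure IsTransition {E : Type*} [NormedAddCommGroup E] [NormedSpace ℝ E]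
    (B : ℝ → E →L[ℝ] E) (W : ℝ → ℝ → E →L[ℝ] E) (μ : ℝ) : Prop where
  norm_le : ∀ t, ‖B t‖ ≤ μ
  self : ∀ s, W s s = ContinuousLinearMap.id ℝ E
  hasDerivAt : ∀ s t, HasDerivAt (fun r => W r s) ((B t).comp (W t s)) t

/-- Exponential decay with constants `K`, `σ`, either forwards or backwards in time. -/
def ExpDecay {E : Type*} [NormedAddCommGroup E] [NormedSpace ℝ E]
    (W : ℝ → ℝ → E →L[ℝ] E) (K σ : ℝ) : Prop :=
  (∀ s t, s ≤ t → ‖W t s‖ ≤ K * Real.exp (-σ * (t - s))) ∨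
    (∀ s t, t ≤ s → ‖W t s‖ ≤ K * Real.exp (-σ * (s - t)))

/-- `x` is continuous and solves `x' = B t x + f t` in the sense of right derivatives. -/
def IsRightSol {E : Type*} [NormedAddCommGroup E] [NormedSpace ℝ E]
    (B : ℝ → E →L[ℝ] E) (f x : ℝ → E) : Prop :=
  Continuous x ∧ ∀ t, HasDerivWithinAt x (B t (x t) + f t) (Ici t) t

section LinearEquation

variable {E : Type*} [NormedAddCommGroup E] [NormedSpace ℝ E]
  {B : ℝ → E →L[ℝ] E} {W : ℝ → ℝ → E →L[ℝ] E} {μ K σ : ℝ}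

lemma IsRightSol.sub {f g x y : ℝ → E} (hx : IsRightSol B f x) (hy : IsRightSol B g y) :
    IsRightSol B (fun t => f t - g t) (fun t => x t - y t) := by
  refine ⟨hx.1.sub hy.1, fun t => ?_⟩
  refine ((hx.2 t).sub (hy.2 t)).congr_deriv ?_
  rw [map_sub]
  exact add_sub_add_comm _ _ _ _

namespace IsTransition

lemma lipschitzWith (hW : IsTransition B W μ) (t : ℝ) :
    LipschitzWith μ.toNNReal (fun x => B t x) := by
  refine (B t).lipschitz.weaken ?_
  rw [← NNReal.coe_le_coe, coe_nnnorm]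
  exact (hW.norm_le t).trans (Real.le_coe_toNNReal μ)

lemma apply_hasDerivAt (hW : IsTransition B W μ) (s t : ℝ) (v : E) :
    HasDerivAt (fun r => W r s v) (B t (W t s v)) t := by
  simpa using (hW.hasDerivAt s t).clm_apply (hasDerivAt_const t v)

lemma comp_apply (hW : IsTransition B W μ) (t s r : ℝ) (v : E) : W t s (W s r v) = W t r v := by
  have h := ODE_solution_unique_univ (v := fun t x => B t x) (s := fun _ => univ)
    (f := fun t => W t s (W s r v)) (g := fun t => W t r v) (t₀ := s)
    (fun t => (hW.lipschitzWith t).lipschitzOnWith)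
    (fun t => ⟨hW.apply_hasDerivAt _ _ _, mem_univ _⟩)
    (fun t => ⟨hW.apply_hasDerivAt _ _ _, mem_univ _⟩) (by simp [hW.self])
  exact congrFun h t

lemma continuous_right [CompleteSpace E] (hW : IsTransition B W μ) (t : ℝ) :
    Continuous (fun s => W t s) := by
  let e : ℝ → (E →L[ℝ] E)ˣ := fun s =>
    { val := W s t
      inv := W t s
      val_inv := by ext v; simp [hW.comp_apply, hW.self]
      inv_val := by ext v; simp [hW.comp_apply, hW.self] }
  have h : (fun s => W t s) = fun s => Ring.inverse (W s t) := by
    funext s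
    exact (Ring.inverse_unit (e s)).symm
  rw [h, continuous_iff_continuousAt]
  intro s
  exact ContinuousAt.comp (f := fun s => W s t) (NormedRing.inverse_continuousAt (e s))
    (hW.hasDerivAt t s).continuousAt

/-- A solution of the homogeneous equation is transported by the transition operator. -/
lemma eq_apply_of_isRightSol (hW : IsTransition B W μ) {x : ℝ → E}
    (hx : IsRightSol B (fun _ => 0) x) {s t : ℝ} (hst : s ≤ t) : x t = W t s (x s) := by
  have h := ODE_solution_unique (v := fun t x => B t x) (f := x) (g := fun t => W t s (x s))
    (a := s) (b := t) hW.lipschitzWith hx.1.continuousOn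
    (fun r _ => by simpa using hx.2 r)
    (fun r _ => (hW.apply_hasDerivAt s r (x s)).continuousAt.continuousWithinAt)
    (fun r _ => (hW.apply_hasDerivAt s r (x s)).hasDerivWithinAt) (by simp [hW.self])
  exact h ⟨hst, le_rfl⟩

lemma eq_zero_of_bounded (hW : IsTransition B W μ) (hd : ExpDecay W K σ) (hσ : 0 < σ)
    {x : ℝ → E} (hx : IsRightSol B (fun _ => 0) x) {C : ℝ} (hC : ∀ t, ‖x t‖ ≤ C) (t : ℝ) :
    x t = 0 := by
  have hC0 : 0 ≤ C := (norm_nonneg _).trans (hC 0)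
  have hlim : Tendsto (fun r : ℝ => K * Real.exp (-σ * r) * C) atTop (nhds 0) := by
    have h1 : Tendsto (fun r : ℝ => -σ * r) atTop atBot :=
      tendsto_id.const_mul_atTop_of_neg (neg_lt_zero.mpr hσ)
    simpa using ((Real.tendsto_exp_atBot.comp h1).const_mul K).mul_const C
  have key : ∀ r : ℝ, 0 ≤ r → ‖x t‖ ≤ K * Real.exp (-σ * r) * C := by
    intro r hr
    rcases hd with h | h
    · rw [hW.eq_apply_of_isRightSol hx (show t - r ≤ t by linarith)]
      refine ((W t (t - r)).le_opNorm _).trans ?_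
      have h' := h (t - r) t (by linarith)
      rw [sub_sub_cancel] at h'
      exact mul_le_mul h' (hC _) (norm_nonneg _) ((norm_nonneg _).trans h')
    · have h1 : x t = W t (t + r) (x (t + r)) := by
        rw [hW.eq_apply_of_isRightSol hx (show t ≤ t + r by linarith), hW.comp_apply, hW.self]
        rfl
      rw [h1]
      refine ((W t (t + r)).le_opNorm _).trans ?_
      have h' := h (t + r) t (by linarith)
      rw [add_sub_cancel_left] at h'
      exact mul_le_mul h' (hC _) (norm_nonneg _) ((norm_nonneg _).trans h')
  have h0 : ‖x t‖ ≤ 0 := ge_of_tendsto hlim ((eventually_ge_atTop 0).mono key)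
  exact norm_le_zero_iff.mp h0

lemma stronglyMeasurable_apply [CompleteSpace E] (hW : IsTransition B W μ) {f : ℝ → E}
    (hf : StronglyMeasurable f) (t : ℝ) : StronglyMeasurable (fun s => W t s (f s)) :=
  isBoundedBilinearMap_apply.continuous.comp_stronglyMeasurable
    ((hW.continuous_right t).stronglyMeasurable.prodMk hf)

lemma intervalIntegrable_apply [CompleteSpace E] (hW : IsTransition B W μ) {f : ℝ → E}
    (hf : StronglyMeasurable f) {M : ℝ} (hM : ∀ t, ‖f t‖ ≤ M) (t a b : ℝ) :
    IntervalIntegrable (fun s => W t s (f s)) volume a b := by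
  have hc : IntervalIntegrable (fun s => ‖W t s‖ * M) volume a b :=
    ((hW.continuous_right t).norm.mul continuous_const).intervalIntegrable a b
  refine hc.mono_fun (hW.stronglyMeasurable_apply hf t).aestronglyMeasurable
    (Eventually.of_forall fun s => ?_)
  refine ((W t s).le_opNorm _).trans ((mul_le_mul_of_nonneg_left (hM s) (norm_nonneg _)).trans ?_)
  exact Real.le_norm_self _

/-- Variation of constants. -/
lemma isRightSol_variation [CompleteSpace E] (hW : IsTransition B W μ) {f : ℝ → E}
    (hf : StronglyMeasurable f) {M : ℝ} (hM : ∀ t, ‖f t‖ ≤ M)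
    (hfc : ∀ t, ContinuousWithinAt f (Ici t) t) (c : E) {x : ℝ → E}
    (hx : ∀ t, x t = W t 0 (c + ∫ s in (0 : ℝ)..t, W 0 s (f s))) :
    IsRightSol B f x ∧ ∀ t, ContinuousAt f t → HasDerivAt x (B t (x t) + f t) t := by
  have hx' : x = fun t => W t 0 (c + ∫ s in (0 : ℝ)..t, W 0 s (f s)) := funext hx
  have hint := hW.intervalIntegrable_apply hf hM 0
  have hmeas := hW.stronglyMeasurable_apply hf 0
  have hval : ∀ t, (B t).comp (W t 0) (c + ∫ s in (0 : ℝ)..t, W 0 s (f s)) +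
      W t 0 (W 0 t (f t)) = B t (x t) + f t := by
    intro t
    rw [hW.comp_apply, hW.self, hx t]
    rfl
  refine ⟨⟨?_, fun t => ?_⟩, fun t ht => ?_⟩
  · have h0 : Continuous fun t => W t 0 :=
      continuous_iff_continuousAt.mpr fun t => (hW.hasDerivAt 0 t).continuousAt
    rw [hx']
    exact h0.clm_apply (continuous_const.add (intervalIntegral.continuous_primitive hint 0))
  · have hcont : ContinuousWithinAt (fun s => W 0 s (f s)) (Ioi t) t :=
      ((hW.continuous_right 0).continuousWithinAt.clm_apply (hfc t)).mono Ioi_subset_Ici_self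
    have h1 : HasDerivWithinAt (fun t => ∫ s in (0 : ℝ)..t, W 0 s (f s)) (W 0 t (f t)) (Ici t) t :=
      intervalIntegral.integral_hasDerivWithinAt_right (hint 0 t)
        hmeas.stronglyMeasurableAtFilter hcont
    have h2 := (hW.hasDerivAt 0 t).hasDerivWithinAt.clm_apply (h1.const_add c)
    rw [hval] at h2
    rwa [hx'] at h2 ⊢
  · have hcont : ContinuousAt (fun s => W 0 s (f s)) t :=
      (hW.continuous_right 0).continuousAt.clm_apply ht
    have h1 := intervalIntegral.integral_hasDerivAt_right (hint 0 t)
        hmeas.stronglyMeasurableAtFilter hcont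
    have h2 := (hW.hasDerivAt 0 t).clm_apply (h1.const_add c)
    rw [hval] at h2
    rwa [hx'] at h2 ⊢

lemma exists_bounded_sol_of_integral [CompleteSpace E] (hW : IsTransition B W μ) {f : ℝ → E}
    (hf : StronglyMeasurable f) {M : ℝ} (hM : ∀ t, ‖f t‖ ≤ M)
    (hfc : ∀ t, ContinuousWithinAt f (Ici t) t) {S : ℝ → Set ℝ} {ε R : ℝ}
    (hint : ∀ t, IntegrableOn (fun s => W t s (f s)) (S t))
    (hS : ∀ t, ε • ∫ s in S t, W 0 s (f s) =
      ε • (∫ s in S 0, W 0 s (f s)) + ∫ s in (0 : ℝ)..t, W 0 s (f s))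
    (hR : ∀ t, ‖ε • ∫ s in S t, W t s (f s)‖ ≤ R) :
    ∃ x : ℝ → E, IsRightSol B f x ∧ (∀ t, ContinuousAt f t → HasDerivAt x (B t (x t) + f t) t) ∧
      ∀ t, ‖x t‖ ≤ R := by
  refine ⟨fun t => ε • ∫ s in S t, W t s (f s), ?_⟩
  rw [← and_assoc]
  refine ⟨hW.isRightSol_variation hf hM hfc (ε • ∫ s in S 0, W 0 s (f s)) fun t => ?_, hR⟩
  have hcomm := (W 0 t).integral_comp_comm (hint t)
  simp only [hW.comp_apply] at hcomm
  rw [← hS, hcomm, map_smul, hW.comp_apply, hW.self]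
  rfl

lemma exists_bounded_sol [CompleteSpace E] (hW : IsTransition B W μ) (hd : ExpDecay W K σ)
    (hσ : 0 < σ) {f : ℝ → E} (hf : StronglyMeasurable f) {M : ℝ} (hM : ∀ t, ‖f t‖ ≤ M)
    (hfc : ∀ t, ContinuousWithinAt f (Ici t) t) :
    ∃ x : ℝ → E, IsRightSol B f x ∧ (∀ t, ContinuousAt f t → HasDerivAt x (B t (x t) + f t) t) ∧
      ∀ t, ‖x t‖ ≤ K * M / σ := by
  have hmeas := hW.stronglyMeasurable_apply hf
  have hshift : ∀ {S : Set ℝ} {r : ℝ}, IntegrableOn (fun s => W r s (f s)) S →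
      ∀ t, IntegrableOn (fun s => W t s (f s)) S := by
    intro S r h t
    have h' := (W t r).integrable_comp h
    simp only [hW.comp_apply] at h'
    exact h'
  rcases hd with h | h
  · have hb : ∀ t s, s ∈ Iic t →
        ‖W t s (f s)‖ ≤ K * M * Real.exp (-σ * t) * Real.exp (σ * s) := by
      intro t s hs
      have h' := h s t hs
      calc ‖W t s (f s)‖ ≤ ‖W t s‖ * ‖f s‖ := (W t s).le_opNorm _
        _ ≤ K * Real.exp (-σ * (t - s)) * M :=
          mul_le_mul h' (hM s) (norm_nonneg _) ((norm_nonneg _).trans h')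
        _ = _ := by
          rw [show -σ * (t - s) = -σ * t + σ * s by ring, Real.exp_add]
          ring
    have hgi : ∀ t, IntegrableOn
        (fun s => K * M * Real.exp (-σ * t) * Real.exp (σ * s)) (Iic t) :=
      fun t => (integrableOn_exp_mul_Iic hσ t).const_mul _
    have hint : ∀ t, IntegrableOn (fun s => W t s (f s)) (Iic t) := fun t =>
      (hgi t).mono' (hmeas t).aestronglyMeasurable
        ((ae_restrict_mem measurableSet_Iic).mono (hb t))
    refine hW.exists_bounded_sol_of_integral hf hM hfc (S := Iic) (ε := 1) hint ?_ ?_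
    · intro t
      rw [← intervalIntegral.integral_Iic_sub_Iic (hint 0) (hshift (hint t) 0)]
      simp
    · intro t
      rw [one_smul]
      refine (norm_integral_le_of_norm_le (hgi t)
        ((ae_restrict_mem measurableSet_Iic).mono (hb t))).trans_eq ?_
      rw [integral_const_mul, integral_exp_mul_Iic hσ, mul_assoc (K * M), ← mul_div_assoc,
        ← Real.exp_add]
      simp [div_eq_mul_inv]
  · have hb : ∀ t s, s ∈ Ioi t →
        ‖W t s (f s)‖ ≤ K * M * Real.exp (σ * t) * Real.exp (-σ * s) := by
      intro t s hs
      have h' := h s t (le_of_lt hs)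
      calc ‖W t s (f s)‖ ≤ ‖W t s‖ * ‖f s‖ := (W t s).le_opNorm _
        _ ≤ K * Real.exp (-σ * (s - t)) * M :=
          mul_le_mul h' (hM s) (norm_nonneg _) ((norm_nonneg _).trans h')
        _ = _ := by
          rw [show -σ * (s - t) = σ * t + -σ * s by ring, Real.exp_add]
          ring
    have hgi : ∀ t, IntegrableOn
        (fun s => K * M * Real.exp (σ * t) * Real.exp (-σ * s)) (Ioi t) :=
      fun t => (integrableOn_exp_mul_Ioi (neg_lt_zero.mpr hσ) t).const_mul _
    have hint : ∀ t, IntegrableOn (fun s => W t s (f s)) (Ioi t) := fun t =>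
      (hgi t).mono' (hmeas t).aestronglyMeasurable
        ((ae_restrict_mem measurableSet_Ioi).mono (hb t))
    refine hW.exists_bounded_sol_of_integral hf hM hfc (S := Ioi) (ε := -1) hint ?_ ?_
    · intro t
      rw [← intervalIntegral.integral_interval_add_Ioi (hint 0) (hshift (hint t) 0)]
      simp
    · intro t
      rw [neg_one_smul, norm_neg]
      refine (norm_integral_le_of_norm_le (hgi t)
        ((ae_restrict_mem measurableSet_Ioi).mono (hb t))).trans_eq ?_
      rw [integral_const_mul, integral_exp_mul_Ioi (neg_lt_zero.mpr hσ), neg_div_neg_eq,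
        mul_assoc (K * M), ← mul_div_assoc, ← Real.exp_add]
      simp [div_eq_mul_inv]

lemma norm_le_of_bounded_sol [CompleteSpace E] (hW : IsTransition B W μ) (hd : ExpDecay W K σ)
    (hσ : 0 < σ) {f x : ℝ → E} (hf : StronglyMeasurable f) {M : ℝ} (hM : ∀ t, ‖f t‖ ≤ M)
    (hfc : ∀ t, ContinuousWithinAt f (Ici t) t) (hx : IsRightSol B f x) {C : ℝ}
    (hC : ∀ t, ‖x t‖ ≤ C) (t : ℝ) : ‖x t‖ ≤ K * M / σ := by
  obtain ⟨y, hy, -, hyM⟩ := hW.exists_bounded_sol hd hσ hf hM hfc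
  have hs := hx.sub hy
  simp only [sub_self] at hs
  have h0 := hW.eq_zero_of_bounded hd hσ hs (C := C + K * M / σ)
    (fun t => (norm_sub_le _ _).trans (add_le_add (hC t) (hyM t))) t
  rw [sub_eq_zero.mp h0]
  exact hyM t

end IsTransition

end LinearEquation

section StepFunction

variable {θ : ℤ → ℝ} {β : ℝ → ℝ}

lemma exists_mem_step (hθtop : Tendsto θ atTop atTop) (hθbot : Tendsto θ atBot atBot)
    (hθmono : StrictMono θ) (t : ℝ) : ∃ i, θ i ≤ t ∧ t < θ (i + 1) := by
  obtain ⟨b, hb⟩ := (hθtop.eventually_gt_atTop t).exists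
  obtain ⟨a, ha⟩ := (hθbot.eventually_le_atBot t).exists
  obtain ⟨i, hi, hmax⟩ := Int.exists_greatest_of_bdd (P := fun i => θ i ≤ t)
    ⟨b, fun z hz => (hθmono.lt_iff_lt.mp (lt_of_le_of_lt hz hb)).le⟩ ⟨a, ha⟩
  refine ⟨i, hi, not_le.mp fun h => ?_⟩
  have := hmax _ h
  omega

lemma monotone_step (hstep : ∀ t, ∃ i, θ i ≤ t ∧ t < θ (i + 1)) (hθmono : StrictMono θ)
    (hβ : ∀ (i : ℤ) (t : ℝ), θ i ≤ t → t < θ (i + 1) → β t = θ i) : Monotone β := by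
  intro s t hst
  obtain ⟨i, hi, hi'⟩ := hstep s
  obtain ⟨j, hj, hj'⟩ := hstep t
  rw [hβ i s hi hi', hβ j t hj hj', hθmono.le_iff_le]
  have := hθmono.lt_iff_lt.mp (hi.trans_lt (hst.trans_lt hj'))
  omega

lemma step_eventuallyEq_right (hstep : ∀ t, ∃ i, θ i ≤ t ∧ t < θ (i + 1))
    (hβ : ∀ (i : ℤ) (t : ℝ), θ i ≤ t → t < θ (i + 1) → β t = θ i) (t : ℝ) :
    ∀ᶠ s in nhdsWithin t (Ici t), β s = β t := by
  obtain ⟨i, hi, hi'⟩ := hstep t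
  filter_upwards [Ico_mem_nhdsGE hi'] with s hs
  rw [hβ i t hi hi', hβ i s (hi.trans hs.1) hs.2]

lemma step_eventuallyEq (hstep : ∀ t, ∃ i, θ i ≤ t ∧ t < θ (i + 1))
    (hβ : ∀ (i : ℤ) (t : ℝ), θ i ≤ t → t < θ (i + 1) → β t = θ i) {t : ℝ}
    (ht : t ∉ range θ) : ∀ᶠ s in nhds t, β s = β t := by
  obtain ⟨i, hi, hi'⟩ := hstep t
  have hlt : θ i < t := lt_of_le_of_ne hi fun h => ht ⟨i, h⟩
  filter_upwards [Ioo_mem_nhds hlt hi'] with s hs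
  rw [hβ i t hi hi', hβ i s hs.1.le hs.2]

variable {Z F : Type*} [NormedAddCommGroup Z] [NormedAddCommGroup F] {g : ℝ → Z → Z → F}
  {z : ℝ → Z}

lemma forcing_continuousWithinAt (hg : Continuous fun p : ℝ × Z × Z => g p.1 p.2.1 p.2.2)
    (hz : Continuous z) {t : ℝ} {s : Set ℝ} (h : ∀ᶠ r in nhdsWithin t s, β r = β t) :
    ContinuousWithinAt (fun r => g r (z r) (z (β r))) s t := by
  have hc : ContinuousWithinAt (fun r => g r (z r) (z (β t))) s t :=
    (hg.comp (continuous_id.prodMk (hz.prodMk continuous_const))).continuousWithinAt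
  exact hc.congr_of_eventuallyEq (h.mono fun r hr => by simp only [hr]) rfl

lemma forcing_stronglyMeasurable (hg : Continuous fun p : ℝ × Z × Z => g p.1 p.2.1 p.2.2)
    (hz : Continuous z) (hβ : Measurable β) :
    StronglyMeasurable (fun r => g r (z r) (z (β r))) :=
  hg.comp_stronglyMeasurable (stronglyMeasurable_id.prodMk
    (hz.stronglyMeasurable.prodMk (hz.comp_stronglyMeasurable hβ.stronglyMeasurable)))

lemma continuous_of_lipschitz {L : ℝ} (hL : 0 ≤ L) (hgc : ∀ a b, Continuous fun t => g t a b)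
    (hlip : ∀ t a b a' b', ‖g t a b - g t a' b'‖ ≤ L * (‖a - a'‖ + ‖b - b'‖)) :
    Continuous fun p : ℝ × Z × Z => g p.1 p.2.1 p.2.2 := by
  refine continuous_prod_of_continuous_lipschitzWith' _ (2 * L).toNNReal (fun t => ?_)
    (fun p => hgc p.1 p.2)
  refine LipschitzWith.of_dist_le_mul fun p q => ?_
  rw [Real.coe_toNNReal _ (by positivity), dist_eq_norm, dist_eq_norm]
  have h1 := norm_fst_le (p - q)
  have h2 := norm_snd_le (p - q)
  calc _ ≤ L * (‖p.1 - q.1‖ + ‖p.2 - q.2‖) := hlip _ _ _ _ _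
    _ ≤ L * (‖p - q‖ + ‖p - q‖) := by gcongr <;> assumption
    _ = _ := by ring

lemma forcing_norm_le {L H : ℝ} (hL : 0 ≤ L)
    (hlip : ∀ t a b a' b', ‖g t a b - g t a' b'‖ ≤ L * (‖a - a'‖ + ‖b - b'‖))
    (hgb : ∀ t, ‖g t 0 0‖ ≤ H) {z : ℝ → Z} {C : ℝ} (hC : ∀ t, ‖z t‖ ≤ C) (t : ℝ) :
    ‖g t (z t) (z (β t))‖ ≤ H + 2 * L * C := by
  have h1 := hlip t (z t) (z (β t)) 0 0
  rw [sub_zero, sub_zero] at h1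
  have h2 : L * (‖z t‖ + ‖z (β t)‖) ≤ L * (C + C) :=
    mul_le_mul_of_nonneg_left (add_le_add (hC _) (hC _)) hL
  have h3 := norm_le_norm_add_norm_sub' (g t (z t) (z (β t))) (g t 0 0)
  linarith [hgb t]

end StepFunction

section Block

open scoped BoundedContinuousFunction

variable {E Z : Type*} [NormedAddCommGroup E] [NormedSpace ℝ E] [CompleteSpace E]
  [NormedAddCommGroup Z] {B : ℝ → E →L[ℝ] E} {W : ℝ → ℝ → E →L[ℝ] E} {μ K σ L H : ℝ}
  {θ : ℤ → ℝ} {β : ℝ → ℝ} {g : ℝ → Z → Z → E}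

/-- The linear equation obtained by freezing a bounded function `z` in the nonlinearity has a
bounded solution. -/
lemma exists_bounded_frozen_sol (hW : IsTransition B W μ) (hd : ExpDecay W K σ) (hσ : 0 < σ)
    (hstep : ∀ t, ∃ i, θ i ≤ t ∧ t < θ (i + 1)) (hθmono : StrictMono θ)
    (hβ : ∀ (i : ℤ) (t : ℝ), θ i ≤ t → t < θ (i + 1) → β t = θ i)
    (hL : 0 ≤ L) (hgc : ∀ a b, Continuous fun t => g t a b)
    (hlip : ∀ t a b a' b', ‖g t a b - g t a' b'‖ ≤ L * (‖a - a'‖ + ‖b - b'‖))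
    (hgb : ∀ t, ‖g t 0 0‖ ≤ H) (z : ℝ →ᵇ Z) :
    ∃ x : ℝ → E, IsRightSol B (fun t => g t (z t) (z (β t))) x ∧
      (∀ t, t ∉ range θ → HasDerivAt x (B t (x t) + g t (z t) (z (β t))) t) ∧
      ∃ C, ∀ t, ‖x t‖ ≤ C := by
  have hg := continuous_of_lipschitz hL hgc hlip
  obtain ⟨x, hx, hx', hxC⟩ := hW.exists_bounded_sol hd hσ
    (forcing_stronglyMeasurable hg z.continuous (monotone_step hstep hθmono hβ).measurable)
    (forcing_norm_le (β := β) hL hlip hgb z.norm_coe_le_norm)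
    fun t => forcing_continuousWithinAt hg z.continuous (step_eventuallyEq_right hstep hβ t)
  refine ⟨x, hx, fun t ht => hx' t ?_, _, hxC⟩
  rw [← continuousWithinAt_univ]
  refine forcing_continuousWithinAt hg z.continuous ?_
  rw [nhdsWithin_univ]
  exact step_eventuallyEq hstep hβ ht

lemma frozen_sol_norm_le (hW : IsTransition B W μ) (hd : ExpDecay W K σ) (hσ : 0 < σ)
    (hstep : ∀ t, ∃ i, θ i ≤ t ∧ t < θ (i + 1)) (hθmono : StrictMono θ)
    (hβ : ∀ (i : ℤ) (t : ℝ), θ i ≤ t → t < θ (i + 1) → β t = θ i)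
    (hL : 0 ≤ L) (hgc : ∀ a b, Continuous fun t => g t a b)
    (hlip : ∀ t a b a' b', ‖g t a b - g t a' b'‖ ≤ L * (‖a - a'‖ + ‖b - b'‖))
    (hgb : ∀ t, ‖g t 0 0‖ ≤ H) (z : ℝ →ᵇ Z) {x : ℝ → E}
    (hx : IsRightSol B (fun t => g t (z t) (z (β t))) x) {C : ℝ} (hC : ∀ t, ‖x t‖ ≤ C) (t : ℝ) :
    ‖x t‖ ≤ K * (H + 2 * L * ‖z‖) / σ := by
  have hg := continuous_of_lipschitz hL hgc hlip
  exact hW.norm_le_of_bounded_sol hd hσ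
    (forcing_stronglyMeasurable hg z.continuous (monotone_step hstep hθmono hβ).measurable)
    (forcing_norm_le (β := β) hL hlip hgb z.norm_coe_le_norm)
    (fun t => forcing_continuousWithinAt hg z.continuous (step_eventuallyEq_right hstep hβ t))
    hx hC t

lemma frozen_sol_dist_le (hW : IsTransition B W μ) (hd : ExpDecay W K σ) (hσ : 0 < σ)
    (hstep : ∀ t, ∃ i, θ i ≤ t ∧ t < θ (i + 1)) (hθmono : StrictMono θ)
    (hβ : ∀ (i : ℤ) (t : ℝ), θ i ≤ t → t < θ (i + 1) → β t = θ i)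
    (hL : 0 ≤ L) (hgc : ∀ a b, Continuous fun t => g t a b)
    (hlip : ∀ t a b a' b', ‖g t a b - g t a' b'‖ ≤ L * (‖a - a'‖ + ‖b - b'‖))
    (z z' : ℝ →ᵇ Z) {x x' : ℝ → E}
    (hx : IsRightSol B (fun t => g t (z t) (z (β t))) x)
    (hx' : IsRightSol B (fun t => g t (z' t) (z' (β t))) x') {C C' : ℝ}
    (hC : ∀ t, ‖x t‖ ≤ C) (hC' : ∀ t, ‖x' t‖ ≤ C') (t : ℝ) :
    ‖x t - x' t‖ ≤ 2 * K * L / σ * dist z z' := by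
  have hg := continuous_of_lipschitz hL hgc hlip
  have hβm := (monotone_step hstep hθmono hβ).measurable
  have hM : ∀ t, ‖g t (z t) (z (β t)) - g t (z' t) (z' (β t))‖ ≤ 2 * L * dist z z' := by
    intro t
    refine (hlip _ _ _ _ _).trans ?_
    have h1 := z.dist_coe_le_dist (g := z') t
    have h2 := z.dist_coe_le_dist (g := z') (β t)
    rw [dist_eq_norm] at h1 h2
    have := mul_le_mul_of_nonneg_left (add_le_add h1 h2) hL
    linarith
  have h := hW.norm_le_of_bounded_sol hd hσ
    ((forcing_stronglyMeasurable hg z.continuous hβm).sub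
      (forcing_stronglyMeasurable hg z'.continuous hβm)) hM
    (fun t => (forcing_continuousWithinAt hg z.continuous
      (step_eventuallyEq_right hstep hβ t)).sub (forcing_continuousWithinAt hg z'.continuous
      (step_eventuallyEq_right hstep hβ t)))
    (hx.sub hx') (fun t => (norm_sub_le _ _).trans (add_le_add (hC t) (hC' t))) t
  refine h.trans_eq ?_
  ring

end Block

theorem stmt_15
    (k m : ℕ) (hk : 1 ≤ k) (hm : 1 ≤ m)
    (θ : ℤ → ℝ) (hθmono : StrictMono θ)
    (θb : ℝ) (hθb : 0 < θb) (hgap : ∀ i : ℤ, θ (i + 1) - θ i ≤ θb)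
    (hθtop : Tendsto θ atTop atTop) (hθbot : Tendsto θ atBot atBot)
    (β : ℝ → ℝ) (hβ : ∀ (i : ℤ) (t : ℝ), θ i ≤ t → t < θ (i + 1) → β t = θ i)
    (Bp : ℝ → Ek k →L[ℝ] Ek k) (Bm : ℝ → Ek m →L[ℝ] Ek m)
    (hBp : Continuous Bp) (hBm : Continuous Bm)
    (U : ℝ → ℝ → Ek k →L[ℝ] Ek k) (V : ℝ → ℝ → Ek m →L[ℝ] Ek m)
    (hUid : ∀ s : ℝ, U s s = ContinuousLinearMap.id ℝ (Ek k))
    (hVid : ∀ s : ℝ, V s s = ContinuousLinearMap.id ℝ (Ek m))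
    (hUderiv : ∀ s t : ℝ, HasDerivAt (fun r => U r s) ((Bp t).comp (U t s)) t)
    (hVderiv : ∀ s t : ℝ, HasDerivAt (fun r => V r s) ((Bm t).comp (V t s)) t)
    (K σ : ℝ) (hK : 1 ≤ K) (hσ : 0 < σ)
    (hU : ∀ s t : ℝ, s ≤ t → ‖U t s‖ ≤ K * Real.exp (-σ * (t - s)))
    (hV : ∀ s t : ℝ, t ≤ s → ‖V t s‖ ≤ K * Real.exp (-σ * (s - t)))
    (gp : ℝ → Ek k × Ek m → Ek k × Ek m → Ek k)
    (gm : ℝ → Ek k × Ek m → Ek k × Ek m → Ek m)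
    (hgpc : ∀ zz ww, Continuous fun t => gp t zz ww)
    (hgmc : ∀ zz ww, Continuous fun t => gm t zz ww)
    (L : ℝ) (hL : 0 < L)
    (hlip : ∀ (t : ℝ) (z₁ w₁ z₂ w₂ : Ek k × Ek m),
      ‖gp t z₁ w₁ - gp t z₂ w₂‖ + ‖gm t z₁ w₁ - gm t z₂ w₂‖ ≤
        L * (‖z₁ - z₂‖ + ‖w₁ - w₂‖))
    (μ : ℝ) (hμ : ∀ t : ℝ, ‖Bp t‖ ≤ μ ∧ ‖Bm t‖ ≤ μ)
    (hbw : L * Real.exp (μ * θb) * θb *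
        (1 + Real.exp (μ * θb) * (1 + L * θb) * Real.exp (Real.exp (μ * θb) * L * θb)) <
      Real.exp (-(μ * θb)))
    (H : ℝ) (hH : 0 < H)
    (hgb : ∀ t : ℝ, ‖gp t 0 0‖ ≤ H ∧ ‖gm t 0 0‖ ≤ H)
    (hsmall : 2 * K * L / σ < 1) :
    ∃ z : ℝ → Ek k × Ek m,
      (SolOn θ β Bp Bm gp gm z Set.univ ∧ ∃ C : ℝ, ∀ t : ℝ, ‖z t‖ ≤ C) ∧
      (∀ t : ℝ, ‖z t‖ ≤ 2 * K * H / (σ - 2 * K * L)) ∧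
      ∀ w : ℝ → Ek k × Ek m,
        (SolOn θ β Bp Bm gp gm w Set.univ ∧ ∃ C : ℝ, ∀ t : ℝ, ‖w t‖ ≤ C) → w = z := by
  have hstep := exists_mem_step hθtop hθbot hθmono
  have hWp : IsTransition Bp U μ := ⟨fun t => (hμ t).1, hUid, hUderiv⟩
  have hWm : IsTransition Bm V μ := ⟨fun t => (hμ t).2, hVid, hVderiv⟩
  have hdp : ExpDecay U K σ := Or.inl hU
  have hdm : ExpDecay V K σ := Or.inr hV
  have hlp : ∀ t a b a' b', ‖gp t a b - gp t a' b'‖ ≤ L * (‖a - a'‖ + ‖b - b'‖) :=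
    fun t a b a' b' => (le_add_of_nonneg_right (norm_nonneg _)).trans (hlip t a b a' b')
  have hlm : ∀ t a b a' b', ‖gm t a b - gm t a' b'‖ ≤ L * (‖a - a'‖ + ‖b - b'‖) :=
    fun t a b a' b' => (le_add_of_nonneg_left (norm_nonneg _)).trans (hlip t a b a' b')
  have hq0 : 0 ≤ 2 * K * L / σ := by positivity
  let P : BoundedContinuousFunction ℝ (Ek k × Ek m) →
      BoundedContinuousFunction ℝ (Ek k × Ek m) → Prop := fun z y =>
    IsRightSol Bp (fun t => gp t (z t) (z (β t))) (fun t => (y t).1) ∧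
      IsRightSol Bm (fun t => gm t (z t) (z (β t))) (fun t => (y t).2)
  have hfst : ∀ (y : BoundedContinuousFunction ℝ (Ek k × Ek m)) t, ‖(y t).1‖ ≤ ‖y‖ :=
    fun y t => (norm_fst_le _).trans (y.norm_coe_le_norm t)
  have hsnd : ∀ (y : BoundedContinuousFunction ℝ (Ek k × Ek m)) t, ‖(y t).2‖ ≤ ‖y‖ :=
    fun y t => (norm_snd_le _).trans (y.norm_coe_le_norm t)
  have hdist : ∀ z z' y y', P z y → P z' y' → dist y y' ≤ 2 * K * L / σ * dist z z' := by
    intro z z' y y' h h'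
    refine (BoundedContinuousFunction.dist_le (mul_nonneg hq0 dist_nonneg)).mpr fun t => ?_
    rw [dist_eq_norm]
    exact max_le
      (frozen_sol_dist_le hWp hdp hσ hstep hθmono hβ hL.le hgpc hlp z z' h.1 h'.1
        (hfst y) (hfst y') t)
      (frozen_sol_dist_le hWm hdm hσ hstep hθmono hβ hL.le hgmc hlm z z' h.2 h'.2
        (hsnd y) (hsnd y') t)
  have hex : ∀ z : BoundedContinuousFunction ℝ (Ek k × Ek m),
      ∃ y : BoundedContinuousFunction ℝ (Ek k × Ek m), P z y ∧ ∀ t, t ∉ Set.range θ →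
        HasDerivAt (fun s => (y s).1) (Bp t (y t).1 + gp t (z t) (z (β t))) t ∧
        HasDerivAt (fun s => (y s).2) (Bm t (y t).2 + gm t (z t) (z (β t))) t := by
    intro z
    obtain ⟨u, hu, hu', C, huC⟩ := exists_bounded_frozen_sol hWp hdp hσ hstep hθmono hβ hL.le
      hgpc hlp (fun t => (hgb t).1) z
    obtain ⟨v, hv, hv', D, hvD⟩ := exists_bounded_frozen_sol hWm hdm hσ hstep hθmono hβ hL.le
      hgmc hlm (fun t => (hgb t).2) z
    exact ⟨BoundedContinuousFunction.ofNormedAddCommGroup (fun t => (u t, v t))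
      (hu.1.prodMk hv.1) (max C D) fun t => max_le_max (huC t) (hvD t),
      ⟨hu, hv⟩, fun t ht => ⟨hu' t ht, hv' t ht⟩⟩
  choose T hTP hTd using hex
  have hcontr : ContractingWith (2 * K * L / σ).toNNReal T := by
    refine ⟨?_, LipschitzWith.of_dist_le_mul fun z z' => ?_⟩
    · rwa [← NNReal.coe_lt_coe, Real.coe_toNNReal _ hq0]
    · rw [Real.coe_toNNReal _ hq0]
      exact hdist z z' _ _ (hTP z) (hTP z')
  let z := hcontr.fixedPoint
  have hz : T z = z := hcontr.fixedPoint_isFixedPt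
  have hzP : P z z := by
    have h := hTP z
    rwa [hz] at h
  have hzd := hTd z
  rw [hz] at hzd
  refine ⟨z, ⟨⟨z.continuous.continuousOn, fun t _ => ⟨?_, fun ht => ?_⟩⟩, ‖z‖,
    z.norm_coe_le_norm⟩, fun t => ?_, fun w hw => ?_⟩
  · rw [inter_univ]
    exact ⟨hzP.1.2 t, hzP.2.2 t⟩
  · exact ⟨(hzd t ht).1.hasDerivWithinAt, (hzd t ht).2.hasDerivWithinAt⟩
  · have hz_le : ‖z‖ ≤ K * (H + 2 * L * ‖z‖) / σ := by
      refine (BoundedContinuousFunction.norm_le (by positivity)).mpr fun t => max_le ?_ ?_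
      · exact frozen_sol_norm_le hWp hdp hσ hstep hθmono hβ hL.le hgpc hlp
          (fun t => (hgb t).1) z hzP.1 (hfst z) t
      · exact frozen_sol_norm_le hWm hdm hσ hstep hθmono hβ hL.le hgmc hlm
          (fun t => (hgb t).2) z hzP.2 (hsnd z) t
    rw [div_lt_one hσ] at hsmall
    rw [le_div_iff₀ hσ] at hz_le
    have hKH : 0 < K * H := by positivity
    refine (z.norm_coe_le_norm t).trans ?_
    rw [le_div_iff₀ (sub_pos.mpr hsmall)]
    linarith
  · obtain ⟨⟨hwc, hw'⟩, C, hC⟩ := hw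
    have hwcont : Continuous w := continuousOn_univ.mp hwc
    let w' : BoundedContinuousFunction ℝ (Ek k × Ek m) :=
      BoundedContinuousFunction.ofNormedAddCommGroup w hwcont C hC
    have hwP : P w' w' := by
      refine ⟨⟨continuous_fst.comp hwcont, fun t => ?_⟩, continuous_snd.comp hwcont, fun t => ?_⟩
      · have h := (hw' t (mem_univ t)).1.1
        rwa [inter_univ] at h
      · have h := (hw' t (mem_univ t)).1.2
        rwa [inter_univ] at h
    have h := hdist w' z w' z hwP hzP
    have h0 : dist w' z = 0 := by
      have := dist_nonneg (x := w') (y := z)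
      nlinarith
    exact congrArg (fun y : BoundedContinuousFunction ℝ (Ek k × Ek m) => (y : ℝ → Ek k × Ek m))
      (dist_eq_zero.mp h0)
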